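/- arXiv:2501.13680 — 2 statements merged into one kernel-verified Lean document; each statement's English description precedes it below -/
import Mathlib

section
/- Let K be a field of characteristic zero and d_1, d_2 positive integers. Consider the planar system x_1' = g_1, x_2' = g_2 with g_1(x_1, x_2) = x_1^{d_1} + x_2^{d_1} and g_2(x_1, x_2) = x_2^{d_2} + 1, and let f_min be the minimal polynomial of the elimination ideal I_g ∩ K[x_1^{(∞)}], where I_g = ⟨x_1' − g_1, x_2' − g_2⟩^(∞). Then f_min contains (with nonzero coefficient) the monomials x_1^{d_1(d_1 + d_2 − 1)} and (x_1'')^{d_1}; moreover, if d_1 > d_2, then f_min also contains the monomial x_1^{d_1(d_1 − 1)}(x_1')^{d_1}. -/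
open MvPolynomial

noncomputable section

/-- The canonical derivation on the ring of differential polynomials
`K[x_i^{(j)} : 1 ≤ i ≤ n, j ≥ 0]`, sending `x_i^{(j)}` to `x_i^{(j+1)}`. -/
def diffDer (K : Type*) [CommRing K] (n : ℕ) :
    Derivation K (MvPolynomial (Fin n × ℕ) K) (MvPolynomial (Fin n × ℕ) K) :=
  MvPolynomial.mkDerivation K fun v => X (v.1, v.2 + 1)

/-- The differential ideal generated by a set `S`: the ideal generated by all
derivatives of elements of `S`. -/
def diffIdeal (K : Type*) [CommRing K] (n : ℕ) (S : Set (MvPolynomial (Fin n × ℕ) K)) :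
    Ideal (MvPolynomial (Fin n × ℕ) K) :=
  Ideal.span {q | ∃ f ∈ S, ∃ j : ℕ, q = (⇑(diffDer K n))^[j] f}

/-- The differential ideal `I_g = ⟨x_1' - g_1, …, x_n' - g_n⟩^(∞)` of the
system `x' = g(x)`. -/
def sysIdeal (K : Type*) [CommRing K] (n : ℕ) (g : Fin n → MvPolynomial (Fin n) K) :
    Ideal (MvPolynomial (Fin n × ℕ) K) :=
  diffIdeal K n (Set.range fun i => X (i, 1) - rename (fun j => (j, 0)) (g i))

/-- The order of a differential polynomial: the largest `j` such that some variable
`x_i^{(j)}` appears. -/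
def ordOf {K : Type*} [CommSemiring K] {n : ℕ} (f : MvPolynomial (Fin n × ℕ) K) : ℕ :=
  f.vars.sup Prod.snd

/-- `f` is a minimal polynomial of the elimination ideal `I ∩ K[x_1^{(∞)}]`:
a nonzero element of `I` involving only the variables `x_1^{(j)}`, of minimal order and
then minimal total degree among all such elements. -/
def IsMinPoly (K : Type*) [Field K] (n : ℕ) [NeZero n]
    (I : Ideal (MvPolynomial (Fin n × ℕ) K)) (f : MvPolynomial (Fin n × ℕ) K) : Prop :=
  f ≠ 0 ∧ f ∈ I ∧ (∀ v ∈ f.vars, v.1 = (0 : Fin n)) ∧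
    ∀ h : MvPolynomial (Fin n × ℕ) K, h ≠ 0 → h ∈ I → (∀ v ∈ h.vars, v.1 = (0 : Fin n)) →
      ordOf f ≤ ordOf h ∧ (ordOf h ≤ ordOf f → f.totalDegree ≤ h.totalDegree)

namespace Polynomial

theorem eval₂_expand_charpoly (K : Type*) [Field K] {d : ℕ} (hd : 0 < d) (e : ℕ) :
    ∃ P : K[X][X], P.Monic ∧ P.natDegree = d ∧
      P.eval₂ (expand K d : K[X] →+* K[X]) (X ^ (d - 1) * (X ^ e + 1)) = 0 := by
  set N : ℕ → Matrix (Fin d) (Fin d) K[X] := fun m => Matrix.of fun i j =>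
    if j = (⟨(i + m) % d, Nat.mod_lt _ hd⟩ : Fin d) then X ^ ((i + m) / d) else 0 with hN
  set E : K[X] →+* K[X] := (expand K d : K[X] →+* K[X]) with hE
  set v : Fin d → K[X] := fun j => X ^ (j : ℕ) with hv
  have key : ∀ m, ((N m).map E).mulVec v = (X ^ m : K[X]) • v := by
    intro m
    ext1 i
    have : ∀ j : Fin d, ((N m).map E) i j * v j =
        if j = (⟨(i + m) % d, Nat.mod_lt _ hd⟩ : Fin d) then X ^ ((i : ℕ) + m) else 0 := by
      intro j
      simp only [hN, hv, Matrix.map_apply, Matrix.of_apply]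
      split_ifs with h
      · subst h
        simp only [hE, RingHom.coe_coe, map_pow, expand_X, ← pow_mul, ← pow_add]
        rw [Nat.div_add_mod]
      · simp
    simp only [Matrix.mulVec, dotProduct, this]
    simp [hv, pow_add, mul_comm]
  refine ⟨(N (d - 1 + e) + N (d - 1)).charpoly, Matrix.charpoly_monic _, ?_, ?_⟩
  · simp [Matrix.charpoly_natDegree_eq_dim]
  · rw [← eval_map, ← Matrix.charpoly_map, Matrix.eval_charpoly]
    rw [← Matrix.exists_mulVec_eq_zero_iff]
    refine ⟨v, ?_, ?_⟩
    · intro h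
      have := congrFun h ⟨0, hd⟩
      simp [hv] at this
    · rw [Matrix.sub_mulVec, Matrix.map_add E (map_add E), Matrix.add_mulVec, key, key]
      ext1 i
      simp [Matrix.scalar_apply]
      ring

theorem exists_generator_ker_eval₂_expand (K : Type*) [Field K] [CharZero K] {d e : ℕ}
    (hd : 0 < d) (he : 0 < e) :
    ∃ P : K[X][X], P.Monic ∧ P.natDegree = d ∧ (P.coeff 0).natDegree = d + e - 1 ∧
      P.eval₂ (expand K d : K[X] →+* K[X]) (X ^ (d - 1) * (X ^ e + 1)) = 0 ∧
      ∀ h : K[X][X],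
        h.eval₂ (expand K d : K[X] →+* K[X]) (X ^ (d - 1) * (X ^ e + 1)) = 0 → P ∣ h := by
  obtain ⟨P, hP, hPd, hP0⟩ := eval₂_expand_charpoly K hd e
  set E : K[X] →+* K[X] := (expand K d : K[X] →+* K[X]) with hE
  set u : K[X] := X ^ (d - 1) * (X ^ e + 1) with hu
  let L := AlgebraicClosure K
  have : NeZero (d : L) := ⟨by exact_mod_cast hd.ne'⟩
  obtain ⟨ζ, hζ⟩ := HasEnoughRootsOfUnity.exists_primitiveRoot L d
  have hζ0 : ζ ≠ 0 := hζ.ne_zero hd.ne'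
  set τ : ℕ → K[X] →+* L[X] := fun i =>
    (compRingHom (C (ζ ^ i) * X)).comp (mapRingHom (algebraMap K L)) with hτ
  set F : K[X] →+* L[X] := (τ 0).comp E with hF
  have hτE : ∀ i, (τ i).comp E = F := by
    intro i
    ext1
    · ext1 a; simp [hF, hτ, hE]
    · have h1 : ((C ζ : L[X]) ^ i) ^ d = 1 := by
        rw [← pow_mul, mul_comm, pow_mul, ← C_pow, hζ.pow_eq_one, C_1, one_pow]
      simp [hF, hτ, hE, mul_pow, h1]
  have hFdeg : ∀ p, (F p).natDegree = d * p.natDegree := by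
    intro p
    simp [hF, hτ, hE, natDegree_expand, mul_comm]
  have hFinj : Function.Injective F := by
    rw [injective_iff_map_eq_zero]
    intro p hp
    simpa [hF, hτ, hE, expand_eq_zero hd] using hp
  set r : Fin d → L[X] := fun i => τ i u with hr
  have hrexp : ∀ i : Fin d, r i =
      C (ζ ^ (i : ℕ)) ^ (d - 1 + e) * X ^ (d - 1 + e) + C (ζ ^ (i : ℕ)) ^ (d - 1) * X ^ (d - 1) := by
    intro i
    simp [hr, hτ, hu]
    ring
  have hrdeg : ∀ i, (r i).natDegree = d - 1 + e := by
    intro i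
    rw [hrexp, ← C_pow, ← C_pow]
    rw [natDegree_add_eq_left_of_natDegree_lt, natDegree_C_mul_X_pow]
    · simp [hζ0]
    · rw [natDegree_C_mul_X_pow _ _ (by simp [hζ0]), natDegree_C_mul_X_pow _ _ (by simp [hζ0])]
      omega
  have hr0 : ∀ i, r i ≠ 0 := by
    intro i h
    have := hrdeg i
    rw [h] at this
    simp at this
    omega
  have hrinj : Function.Injective r := by
    intro i j hij
    have h1 : (ζ ^ (i : ℕ)) ^ (d - 1) = (ζ ^ (j : ℕ)) ^ (d - 1) := by
      have := congrArg (fun p => coeff p (d - 1)) hij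
      simp only [hrexp, ← C_pow, coeff_add, coeff_C_mul, coeff_X_pow] at this
      simpa [he.ne'] using this
    have h2 : ∀ k : ℕ, (ζ ^ k) ^ (d - 1) * ζ ^ k = 1 := by
      intro k
      rw [← pow_succ, Nat.sub_add_cancel hd, ← pow_mul, mul_comm, pow_mul, hζ.pow_eq_one, one_pow]
    have h3 : ζ ^ (i : ℕ) = ζ ^ (j : ℕ) := by
      have a := h2 i
      have b := h2 j
      rw [h1, ← b] at a
      exact mul_left_cancel₀ (by simp [hζ0]) a
    exact Fin.ext (hζ.pow_inj i.2 j.2 h3)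
  have hroot : ∀ h : K[X][X], h.eval₂ E u = 0 → ∀ i, (h.map F).eval (r i) = 0 := by
    intro h hh i
    rw [← hτE i, eval_map, hr, ← hom_eval₂, hh, map_zero]
  have hvan : ∀ q : L[X][X], q.natDegree < d → (∀ i, q.eval (r i) = 0) → q = 0 := by
    intro q hq hq0
    exact eq_zero_of_natDegree_lt_card_of_eval_eq_zero q hrinj hq0 (by simpa using hq)
  have hprod : P.map F = ∏ i, (X - C (r i)) := by
    have hm : (∏ i, (X - C (r i))).Monic := monic_prod_of_monic _ _ fun i _ => monic_X_sub_C _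
    have hmd : (∏ i, (X - C (r i))).natDegree = d := by simp
    rw [← sub_eq_zero]
    apply hvan
    · by_cases h0 : P.map F - ∏ i, (X - C (r i)) = 0
      · simpa [h0] using hd
      rw [natDegree_lt_iff_degree_lt h0]
      have := degree_sub_lt_left (p := P.map F) (q := ∏ i, (X - C (r i))) ?_ (hP.map F).ne_zero ?_
      · rwa [degree_eq_natDegree (hP.map F).ne_zero, hP.natDegree_map, hPd] at this
      · rw [degree_eq_natDegree (hP.map F).ne_zero, degree_eq_natDegree hm.ne_zero,
          hP.natDegree_map, hPd, hmd]
      · rw [(hP.map F).leadingCoeff, hm.leadingCoeff]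
    · intro i
      rw [eval_sub, hroot P hP0, eval_prod, Finset.prod_eq_zero (Finset.mem_univ i) (by simp),
        sub_zero]
  refine ⟨P, hP, hPd, ?_, hP0, ?_⟩
  · have h1 : F (P.coeff 0) = ∏ i, (- r i) := by
      rw [← coeff_map, hprod, coeff_zero_eq_eval_zero, eval_prod]
      simp
    have h2 := congrArg natDegree h1
    rw [hFdeg, natDegree_prod _ _ fun i _ => neg_ne_zero.2 (hr0 i)] at h2
    simp only [natDegree_neg, hrdeg, Finset.sum_const, Finset.card_univ, Fintype.card_fin,
      smul_eq_mul] at h2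
    have := Nat.eq_of_mul_eq_mul_left hd h2
    omega
  · intro h hh
    rw [← modByMonic_eq_zero_iff_dvd hP]
    have hdeg : (h %ₘ P).natDegree < d := by
      rw [← hPd]
      exact natDegree_modByMonic_lt _ hP fun h1 => by
        rw [h1, natDegree_one] at hPd; omega
    have h0 : (h %ₘ P).eval₂ E u = 0 := by
      rw [modByMonic_eq_sub_mul_div, eval₂_sub, eval₂_mul, hP0, hh]; simp
    have := hvan ((h %ₘ P).map F) (natDegree_map_le.trans_lt hdeg) (hroot _ h0)
    exact (Polynomial.map_eq_zero_iff hFinj).1 this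

theorem eval₂_X_sub_C_coeff {K : Type*} [CommRing K] (q a : K[X]) (k : ℕ) :
    (a.eval₂ ((C : K[X] →+* K[X][X]).comp C) (X - C q)).coeff k = (hasseDeriv k a).comp (-q) := by
  have h1 : a.eval₂ ((C : K[X] →+* K[X][X]).comp C) (X - C q) = taylor (-q) (a.map C) := by
    rw [taylor_apply, comp, eval₂_map, C_neg, sub_eq_add_neg]
  have h2 : hasseDeriv k (a.map (C : K →+* K[X])) = (hasseDeriv k a).map C := by
    ext1 n
    simp [hasseDeriv_coeff]
  rw [h1, taylor_coeff, h2, eval_map, comp]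

theorem coeff_comp_neg_X_pow_eq_zero {K : Type*} [CommRing K] {d m : ℕ} (hd : 0 < d) (b : K[X])
    (h : ¬ d ∣ m) : (b.comp (-X ^ d)).coeff m = 0 := by
  have : b.comp (-X ^ d) = expand K d (b.comp (-X)) := by
    rw [expand_eq_comp_X_pow, comp_assoc]; simp
  rw [this, coeff_expand hd, if_neg h]

theorem coeff_eval₂_neg_C_mul_X_ne_zero {K : Type*} [Field K] {d e : ℕ} (he : 0 < e) (hed : e < d)
    {P : K[X][X]} (hP : P.Monic) (hPd : P.natDegree = d)
    (hP0 : (P.coeff 0).natDegree = d + e - 1) :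
    ((P.eval₂ (eval₂RingHom ((C : K[X] →+* K[X][X]).comp C) (X - C (X ^ d)))
      (C (-X ^ (d - 1)) * X)).coeff d).coeff (d * (d - 1)) ≠ 0 := by
  have hd : 0 < d := by omega
  set α : K[X] →+* K[X][X] := eval₂RingHom ((C : K[X] →+* K[X][X]).comp C) (X - C (X ^ d)) with hα
  have hαc : ∀ a k, (α a).coeff k = (hasseDeriv k a).comp (-X ^ d) := fun a k =>
    eval₂_X_sub_C_coeff _ _ _
  have hterm : ∀ a i, i ≤ d → (α a * (C (-X ^ (d - 1)) * X) ^ i).coeff d =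
      (-1) ^ i * (X ^ ((d - 1) * i) * (hasseDeriv (d - i) a).comp (-X ^ d)) := by
    intro a i hi
    have : α a * (C (-X ^ (d - 1)) * X) ^ i =
        C ((-1) ^ i * X ^ ((d - 1) * i)) * (α a * X ^ i) := by
      rw [mul_pow, ← C_pow, neg_pow, pow_mul]
      ring
    rw [this, coeff_C_mul, coeff_mul_X_pow', if_pos hi, hαc]
    ring
  rw [eval₂_eq_sum_range, finsetSum_coeff, finsetSum_coeff, hPd, Finset.sum_range_succ,
    Finset.sum_eq_zero]
  · have h1 : P.coeff d = 1 := by rw [← hPd]; exact hP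
    rw [hterm _ _ le_rfl, h1, Nat.sub_self]
    have h2 : ((-1 : K[X]) ^ d) = C ((-1) ^ d) := by simp
    simp [h2, -map_pow, mul_comm d]
  · intro i hi
    have hi := Finset.mem_range.1 hi
    rw [hterm _ _ hi.le]
    have h2 : ((-1 : K[X]) ^ i) = C ((-1) ^ i) := by simp
    rw [h2, coeff_C_mul, coeff_X_pow_mul']
    split_ifs with hle
    · rcases Nat.eq_zero_or_pos i with rfl | hi0
      · rw [coeff_eq_zero_of_natDegree_lt, mul_zero]
        rw [natDegree_comp, natDegree_neg, natDegree_X_pow]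
        have := natDegree_hasseDeriv_le (P.coeff 0) (d - 0)
        rw [hP0] at this
        calc _ ≤ (e - 1) * d := Nat.mul_le_mul_right _ (by omega)
          _ < (d - 1) * d := Nat.mul_lt_mul_of_pos_right (by omega) hd
          _ = _ := by rw [mul_zero, mul_comm, Nat.sub_zero]
      · rw [coeff_comp_neg_X_pow_eq_zero hd, mul_zero]
        intro hdiv
        rw [Nat.dvd_sub_iff_right hle (dvd_mul_right _ _)] at hdiv
        have hc : Nat.Coprime d (d - 1) := by
          rw [Nat.coprime_self_sub_right hd]; simp
        exact absurd (Nat.le_of_dvd hi0 (hc.dvd_of_dvd_mul_left hdiv)) (by omega)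
    · simp

theorem coeff_comp_C_mul_X_ne_zero {K : Type*} [Field K] {d : ℕ}
    {Q : K[X]} (hQ : Q.Monic) (hQd : Q.natDegree = d) {c : K} (hc : c ≠ 0) :
    (Q.comp (C c * X)).coeff d ≠ 0 := by
  have h1 : (Q.comp (C c * X)).natDegree = d := by simp [natDegree_comp, hQd, hc]
  have h2 : (Q.comp (C c * X)).leadingCoeff ≠ 0 := by
    rw [leadingCoeff_comp (by simp [hc])]
    simp [hQ.leadingCoeff, hc]
  rwa [leadingCoeff, h1] at h2

end Polynomial

section

open scoped Polynomial

namespace MvPolynomial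

theorem coeff_single_add_single {σ K : Type*} [CommRing K] [DecidableEq σ] {v w : σ} (hvw : v ≠ w)
    (f : MvPolynomial σ K) (a b : ℕ) :
    f.coeff (Finsupp.single v a + Finsupp.single w b) =
      ((aeval (fun i => if i = v then Polynomial.C Polynomial.X else
        if i = w then Polynomial.X else (0 : K[X][X])) f).coeff b).coeff a := by
  induction f using MvPolynomial.induction_on' with
  | add p q hp hq => simp [hp, hq]
  | monomial m c =>
    rw [aeval_monomial, coeff_monomial]
    have halg : algebraMap K K[X][X] c = Polynomial.C (Polynomial.C c) := rfl
    by_cases hm : ∀ i, i ≠ v → i ≠ w → m i = 0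
    · obtain ⟨a', b', rfl⟩ : ∃ a' b', m = Finsupp.single v a' + Finsupp.single w b' := by
        refine ⟨m v, m w, ?_⟩
        ext i
        by_cases h1 : i = v
        · subst h1; simp [hvw.symm]
        · by_cases h2 : i = w
          · subst h2; simp [hvw]
          · simp [hm i h1 h2, Ne.symm h1, Ne.symm h2]
      have hiff : Finsupp.single v a' + Finsupp.single w b' =
          Finsupp.single v a + Finsupp.single w b ↔ b = b' ∧ a = a' := by
        constructor
        · intro h
          have h1 := DFunLike.congr_fun h v
          have h2 := DFunLike.congr_fun h w
          simp [hvw, hvw.symm] at h1 h2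
          exact ⟨h2.symm, h1.symm⟩
        · rintro ⟨rfl, rfl⟩; rfl
      rw [Finsupp.prod_add_index' (fun _ => pow_zero _) (fun _ _ _ => pow_add _ _ _),
        Finsupp.prod_single_index (by simp), Finsupp.prod_single_index (by simp), halg,
        if_pos rfl, if_neg hvw.symm, if_pos rfl, ← Polynomial.C_pow, Polynomial.coeff_C_mul,
        Polynomial.coeff_C_mul, Polynomial.coeff_C_mul, Polynomial.coeff_X_pow]
      simp only [hiff]
      by_cases hb : b = b' <;> by_cases ha : a = a' <;> simp [hb, ha, Polynomial.coeff_X_pow]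
    · push Not at hm
      obtain ⟨i, h1, h2, h3⟩ := hm
      have hprod : (m.prod fun i k => (if i = v then Polynomial.C Polynomial.X else
          if i = w then Polynomial.X else (0 : K[X][X])) ^ k) = 0 := by
        apply Finset.prod_eq_zero (Finsupp.mem_support_iff.2 h3)
        simp [h1, h2, h3]
      rw [hprod, if_neg]
      · simp
      · rintro rfl
        simp [Ne.symm h1, Ne.symm h2] at h3

theorem coeff_single_eq_coeff_aeval {σ K : Type*} [CommRing K] [DecidableEq σ] {v w : σ}
    (hvw : v ≠ w) (f : MvPolynomial σ K) (a : ℕ) :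
    f.coeff (Finsupp.single v a) =
      (aeval (fun i => if i = v then Polynomial.X else (0 : K[X])) f).coeff a := by
  have h := coeff_single_add_single hvw f a 0
  rw [Finsupp.single_zero, add_zero] at h
  rw [h, Polynomial.coeff_zero_eq_eval_zero]
  congr 1
  rw [← Polynomial.coe_evalRingHom, map_aeval, aeval_def, coe_eval₂Hom]
  congr 1
  · ext1 x
    exact Polynomial.eval_C
  · ext1 i
    split_ifs <;> simp

end MvPolynomial

end

section Differential

variable {K : Type*} [CommRing K] {n : ℕ}

/-- The substitution of a formal solution of the system `x' = g(x)`: it sends `x_i^{(j)}` to the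
`j`-th derivative of `x_i` along the vector field `g`. -/
def solHom (g : Fin n → MvPolynomial (Fin n) K) :
    MvPolynomial (Fin n × ℕ) K →ₐ[K] MvPolynomial (Fin n) K :=
  aeval fun v => (mkDerivation K g)^[v.2] (X v.1)

theorem solHom_X (g : Fin n → MvPolynomial (Fin n) K) (i : Fin n) (j : ℕ) :
    solHom g (X (i, j)) = (mkDerivation K g)^[j] (X i) := by
  simp [solHom]

theorem solHom_C (g : Fin n → MvPolynomial (Fin n) K) (c : K) : solHom g (C c) = C c :=
  aeval_C _ _

theorem solHom_diffDer (g : Fin n → MvPolynomial (Fin n) K) (p : MvPolynomial (Fin n × ℕ) K) :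
    solHom g (diffDer K n p) = mkDerivation K g (solHom g p) := by
  induction p using MvPolynomial.induction_on with
  | C a => simp [diffDer, solHom]
  | add p q hp hq => simp [hp, hq]
  | mul_X p v hp =>
    rw [Derivation.leibniz, map_mul, Derivation.leibniz, map_add, smul_eq_mul, smul_eq_mul,
      map_mul, map_mul, hp]
    have : solHom g (diffDer K n (X v)) = mkDerivation K g (solHom g (X v)) := by
      rw [diffDer, mkDerivation_X, solHom_X, solHom_X, Function.iterate_succ_apply']
    rw [this]
    rfl

theorem solHom_eq_zero_of_mem_sysIdeal (g : Fin n → MvPolynomial (Fin n) K)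
    {p : MvPolynomial (Fin n × ℕ) K} (hp : p ∈ sysIdeal K n g) : solHom g p = 0 := by
  suffices h : sysIdeal K n g ≤ RingHom.ker (solHom g) from h hp
  refine Ideal.span_le.2 ?_
  rintro _ ⟨_, ⟨i, rfl⟩, j, rfl⟩
  have hcomm : ∀ q, solHom g ((diffDer K n)^[j] q) = (mkDerivation K g)^[j] (solHom g q) :=
    Function.Semiconj.iterate_right (f := solHom g) (solHom_diffDer g) j
  have hren : solHom g (rename (fun k => (k, 0)) (g i)) = g i := by
    rw [solHom, aeval_rename]
    exact aeval_X_left_apply _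
  rw [SetLike.mem_coe, RingHom.mem_ker, hcomm, map_sub, hren, solHom_X, Function.iterate_one,
    mkDerivation_X, sub_self]
  exact Function.iterate_fixed (map_zero _) j

theorem iterate_diffDer_mem_sysIdeal (g : Fin n → MvPolynomial (Fin n) K) (i : Fin n) (j : ℕ) :
    (diffDer K n)^[j] (X (i, 1) - rename (fun k => (k, 0)) (g i)) ∈ sysIdeal K n g :=
  Ideal.subset_span ⟨_, ⟨i, rfl⟩, j, rfl⟩

end Differential

section System

open Polynomial (eval₂RingHom)

variable {K : Type*} [Field K]

/-- The right-hand side of the planar system `x_1' = x_1^d + x_2^d`, `x_2' = x_2^e + 1`. -/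
abbrev powField (K : Type*) [Field K] (d e : ℕ) : Fin 2 → MvPolynomial (Fin 2) K :=
  ![X 0 ^ d + X 1 ^ d, X 1 ^ e + 1]

/-- The ring homomorphism `K[w][u] → K[x_1^{(∞)}, x_2^{(∞)}]` with `w ↦ x_1' - x_1^d` and
`u ↦ x_1'' / d - x_1^{d-1} x_1'`. -/
def elimHom (K : Type*) [Field K] (d : ℕ) :
    Polynomial (Polynomial K) →+* MvPolynomial (Fin 2 × ℕ) K :=
  eval₂RingHom (eval₂RingHom C (X (0, 1) - X (0, 0) ^ d))
    (C (d : K)⁻¹ * X (0, 2) - X (0, 0) ^ (d - 1) * X (0, 1))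

/-- The ring homomorphism `K[w][u] → K[y]` with `w ↦ y^d` and `u ↦ y^{d-1} (y^e + 1)`. -/
abbrev parHom (K : Type*) [Field K] (d e : ℕ) : Polynomial (Polynomial K) →+* Polynomial K :=
  eval₂RingHom (Polynomial.expand K d : Polynomial K →+* Polynomial K)
    (Polynomial.X ^ (d - 1) * (Polynomial.X ^ e + 1))

/-- The variables `x_1, x_1', x_1''`. -/
abbrev lowVars : Set (Fin 2 × ℕ) := {(0, 0), (0, 1), (0, 2)}

theorem elimHom_mem_supported (d : ℕ) (P : Polynomial (Polynomial K)) :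
    elimHom K d P ∈ supported K lowVars := by
  have hX : ∀ v ∈ lowVars, (X v : MvPolynomial (Fin 2 × ℕ) K) ∈ supported K lowVars :=
    fun v hv => X_mem_supported.2 hv
  have h0 := hX (0, 0) (by simp)
  have h1 := hX (0, 1) (by simp)
  have h2 := hX (0, 2) (by simp)
  have hC : ∀ c, (C c : MvPolynomial (Fin 2 × ℕ) K) ∈ supported K lowVars :=
    fun c => (supported K lowVars).algebraMap_mem c
  have hle : ∀ Q : Polynomial K,
      Q.eval₂ C (X (0, 1) - X (0, 0) ^ d) ∈ supported K lowVars := by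
    intro Q
    rw [Polynomial.eval₂_eq_sum, Polynomial.sum]
    exact sum_mem fun i _ => mul_mem (hC _) (pow_mem (sub_mem h1 (pow_mem h0 _)) _)
  rw [elimHom, Polynomial.coe_eval₂RingHom, Polynomial.eval₂_eq_sum, Polynomial.sum]
  exact sum_mem fun i _ => mul_mem (hle _)
    (pow_mem (sub_mem (mul_mem (hC _) h2) (mul_mem (pow_mem h0 _) h1)) _)

theorem mem_supported_lowVars {f : MvPolynomial (Fin 2 × ℕ) K} (h1 : ∀ v ∈ f.vars, v.1 = 0)
    (h2 : ordOf f ≤ 2) : f ∈ supported K lowVars := by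
  rw [mem_supported]
  intro v hv
  have ha := h1 v hv
  have hb : v.2 ≤ 2 := (Finset.le_sup (f := Prod.snd) hv).trans h2
  obtain ⟨i, j⟩ := v
  simp only at ha hb
  subst ha
  interval_cases j <;> simp

theorem exists_eval₂_elimHom_eq [CharZero K] {d : ℕ} (hd : 0 < d) {f : MvPolynomial (Fin 2 × ℕ) K}
    (hf : f ∈ supported K lowVars) :
    ∃ H : Polynomial (Polynomial (Polynomial K)), H.eval₂ (elimHom K d) (X (0, 0)) = f := by
  have hd0 : (d : K) ≠ 0 := by exact_mod_cast hd.ne'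
  set ψ := eval₂RingHom (elimHom K d) (X (0, 0))
  suffices h : f ∈ ψ.rangeS from h
  have h0 : ψ Polynomial.X = X (0, 0) := by simp [ψ]
  have hC : ∀ c, C c ∈ ψ.rangeS := fun c =>
    ⟨Polynomial.C (Polynomial.C (Polynomial.C c)), by simp [ψ, elimHom]⟩
  have hw : X (0, 1) - X (0, 0) ^ d ∈ ψ.rangeS :=
    ⟨Polynomial.C (Polynomial.C Polynomial.X), by simp [ψ, elimHom]⟩
  have hu : C (d : K)⁻¹ * X (0, 2) - X (0, 0) ^ (d - 1) * X (0, 1) ∈ ψ.rangeS :=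
    ⟨Polynomial.C Polynomial.X, by simp [ψ, elimHom]⟩
  have hx0 : X (0, 0) ∈ ψ.rangeS := ⟨_, h0⟩
  have hx1 : X (0, 1) ∈ ψ.rangeS := by
    have := add_mem hw (pow_mem hx0 d)
    rwa [sub_add_cancel] at this
  have hx2 : X (0, 2) ∈ ψ.rangeS := by
    have := mul_mem (hC d) (add_mem hu (mul_mem (pow_mem hx0 (d - 1)) hx1))
    rwa [sub_add_cancel, ← mul_assoc, ← C_mul, mul_inv_cancel₀ hd0, C_1, one_mul] at this
  rw [supported_eq_adjoin_X] at hf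
  induction hf using Algebra.adjoin_induction with
  | mem x hx =>
    obtain ⟨v, rfl | rfl | rfl, rfl⟩ := hx
    exacts [hx0, hx1, hx2]
  | algebraMap r => exact hC r
  | add x y _ _ hx hy => exact add_mem hx hy
  | mul x y _ _ hx hy => exact mul_mem hx hy

theorem map_parHom_eq_zero [CharZero K] {d : ℕ} (e : ℕ) (hd : 0 < d)
    {H : Polynomial (Polynomial (Polynomial K))}
    (hH : H.eval₂ (elimHom K d) (X (0, 0)) ∈ sysIdeal K 2 (powField K d e)) :
    H.map (parHom K d e) = 0 := by
  have hd0 : (d : K) ≠ 0 := by exact_mod_cast hd.ne'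
  set E : MvPolynomial (Fin 2) K →ₐ[K] Polynomial (Polynomial K) :=
    aeval ![Polynomial.X, Polynomial.C Polynomial.X] with hE
  have hEC : ∀ c, E (C c) = Polynomial.C (Polynomial.C c) := fun c => by
    rw [hE, aeval_C]; rfl
  have key : ((E : MvPolynomial (Fin 2) K →+* _).comp
      (solHom (powField K d e) : MvPolynomial (Fin 2 × ℕ) K →+* _)).comp
      (eval₂RingHom (elimHom K d) (X (0, 0))) = Polynomial.mapRingHom (parHom K d e) := by
    have hx0 : E (solHom (powField K d e) (X (0, 0))) = Polynomial.X := by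
      simp [solHom_X, hE]
    have hx1 : E (solHom (powField K d e) (X (0, 1))) =
        Polynomial.X ^ d + Polynomial.C Polynomial.X ^ d := by
      simp [solHom_X, hE]
    have hx2 : E (solHom (powField K d e) (X (0, 2))) = Polynomial.C (Polynomial.C (d : K)) *
        (Polynomial.X ^ (d - 1) * (Polynomial.X ^ d + Polynomial.C Polynomial.X ^ d) +
        Polynomial.C Polynomial.X ^ (d - 1) * (Polynomial.C Polynomial.X ^ e + 1)) := by
      simp [solHom_X, hE, Derivation.leibniz_pow]
      ring
    ext1
    · ext1
      · ext1
        · ext1 c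
          simp [elimHom, hEC]
        · simp [elimHom, hx0, hx1]
      · have hdd : Polynomial.C (Polynomial.C (d : K)⁻¹) * Polynomial.C (Polynomial.C (d : K)) =
            1 := by
          rw [← Polynomial.C_mul, ← Polynomial.C_mul, inv_mul_cancel₀ hd0, Polynomial.C_1,
            Polynomial.C_1]
        simp only [elimHom, RingHom.comp_apply, Polynomial.coe_eval₂RingHom, Polynomial.eval₂_X,
          Polynomial.eval₂_C, RingHom.coe_coe, map_sub, map_mul, map_pow, map_add, map_one, hx0,
          hx1, hx2, hEC, solHom_C, Polynomial.coe_mapRingHom, Polynomial.map_C]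
        linear_combination (Polynomial.X ^ (d - 1) *
          (Polynomial.X ^ d + Polynomial.C Polynomial.X ^ d) +
          Polynomial.C Polynomial.X ^ (d - 1) * (Polynomial.C Polynomial.X ^ e + 1)) * hdd
    · simp [hx0]
  have h := solHom_eq_zero_of_mem_sysIdeal _ hH
  have h' := RingHom.congr_fun key H
  simp only [RingHom.comp_apply, RingHom.coe_coe, Polynomial.coe_eval₂RingHom, h, map_zero,
    Polynomial.coe_mapRingHom] at h'
  exact h'.symm

theorem elimHom_mem_sysIdeal [CharZero K] {d e : ℕ} (hd : 0 < d)
    {P : Polynomial (Polynomial K)} (hP : parHom K d e P = 0) :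
    elimHom K d P ∈ sysIdeal K 2 (powField K d e) := by
  have hd0 : (d : K) ≠ 0 := by exact_mod_cast hd.ne'
  set I := sysIdeal K 2 (powField K d e)
  set q := Ideal.Quotient.mk I with hq
  have h0 : q (X (0, 1)) = q (X (0, 0)) ^ d + q (X (1, 0)) ^ d := by
    have h := Ideal.Quotient.eq_zero_iff_mem.2
      (iterate_diffDer_mem_sysIdeal (powField K d e) 0 0)
    simpa [sub_eq_zero, hq] using h
  have h1 : q (X (1, 1)) = q (X (1, 0)) ^ e + 1 := by
    have h := Ideal.Quotient.eq_zero_iff_mem.2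
      (iterate_diffDer_mem_sysIdeal (powField K d e) 1 0)
    simpa [sub_eq_zero, hq] using h
  have h2 : q (X (0, 2)) = q (C (d : K)) * (q (X (0, 0)) ^ (d - 1) * q (X (0, 1)) +
      q (X (1, 0)) ^ (d - 1) * q (X (1, 1))) := by
    have h := Ideal.Quotient.eq_zero_iff_mem.2
      (iterate_diffDer_mem_sysIdeal (powField K d e) 0 1)
    have h' : diffDer K 2 (X (0, 1) - rename (fun k => (k, 0)) (powField K d e 0)) =
        X (0, 2) - C (d : K) * (X (0, 0) ^ (d - 1) * X (0, 1) +
          X (1, 0) ^ (d - 1) * X (1, 1)) := by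
      simp [diffDer, Derivation.leibniz_pow]
      ring
    rw [Function.iterate_one, h'] at h
    simpa only [map_sub, map_mul, map_add, map_pow, sub_eq_zero] using h
  have key : q.comp (elimHom K d) =
      (eval₂RingHom (q.comp C) (q (X (1, 0)))).comp (parHom K d e) := by
    ext1
    · ext1
      · ext1 c
        simp [elimHom]
      · simp [elimHom, h0]
    · have hdd : q (C (d : K)⁻¹) * q (C (d : K)) = 1 := by
        rw [← map_mul, ← C_mul, inv_mul_cancel₀ hd0, C_1, map_one]
      simp only [elimHom, RingHom.comp_apply, Polynomial.coe_eval₂RingHom, Polynomial.eval₂_X,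
        map_sub, map_mul, map_pow, h2, h1, Polynomial.eval₂_pow,
        Polynomial.eval₂_add, Polynomial.eval₂_one]
      linear_combination (q (X (0, 0)) ^ (d - 1) * q (X (0, 1)) +
        q (X (1, 0)) ^ (d - 1) * (q (X (1, 0)) ^ e + 1)) * hdd
  rw [← Ideal.Quotient.eq_zero_iff_mem]
  have h := RingHom.congr_fun key P
  simpa only [RingHom.comp_apply, hP, map_zero] using h

theorem elimHom_dvd_of_mem_sysIdeal [CharZero K] {d e : ℕ} (hd : 0 < d)
    {P : Polynomial (Polynomial K)} (hP : ∀ h, parHom K d e h = 0 → P ∣ h)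
    {f : MvPolynomial (Fin 2 × ℕ) K} (hf : f ∈ sysIdeal K 2 (powField K d e))
    (hs : f ∈ supported K lowVars) : elimHom K d P ∣ f := by
  obtain ⟨H, rfl⟩ := exists_eval₂_elimHom_eq hd hs
  have h0 := map_parHom_eq_zero e hd hf
  have hdvd : Polynomial.C P ∣ H := by
    rw [Polynomial.C_dvd_iff_dvd_coeff]
    intro i
    apply hP
    rw [← Polynomial.coeff_map, h0, Polynomial.coeff_zero]
  have := map_dvd (eval₂RingHom (elimHom K d) (X (0, 0))) hdvd
  simpa using this

theorem coeff_x_elimHom_ne_zero {d e : ℕ} (hd : 0 < d) {P : Polynomial (Polynomial K)}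
    (hP0 : (P.coeff 0).natDegree = d + e - 1) (he : 0 < e) :
    (elimHom K d P).coeff (Finsupp.single (0, 0) (d * (d + e - 1))) ≠ 0 := by
  have hvw : ((0, 0) : Fin 2 × ℕ) ≠ (0, 1) := by simp
  set σ : MvPolynomial (Fin 2 × ℕ) K →ₐ[K] Polynomial K :=
    aeval (fun i => if i = (0, 0) then Polynomial.X else 0) with hσ
  have key : (σ : _ →+* Polynomial K).comp (elimHom K d) =
      eval₂RingHom (eval₂RingHom Polynomial.C (-Polynomial.X ^ d)) 0 := by
    ext1
    · ext1
      · ext1 c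
        simp [elimHom, hσ]
      · simp [elimHom, hσ]
    · simp [elimHom, hσ]
  have h : σ (elimHom K d P) = (P.coeff 0).comp (-Polynomial.X ^ d) := by
    have := RingHom.congr_fun key P
    simp only [RingHom.comp_apply, RingHom.coe_coe, Polynomial.coe_eval₂RingHom,
      Polynomial.eval₂_at_zero] at this
    exact this
  rw [coeff_single_eq_coeff_aeval hvw, ← hσ, h]
  have hdeg : ((P.coeff 0).comp (-Polynomial.X ^ d)).natDegree = d * (d + e - 1) := by
    rw [Polynomial.natDegree_comp, Polynomial.natDegree_neg, Polynomial.natDegree_X_pow, hP0,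
      mul_comm]
  rw [← hdeg, Polynomial.coeff_natDegree, Polynomial.leadingCoeff_ne_zero]
  intro h0
  rw [h0, Polynomial.natDegree_zero] at hdeg
  have : 0 < d * (d + e - 1) := Nat.mul_pos hd (by omega)
  omega

theorem coeff_x''_elimHom_ne_zero [CharZero K] {d : ℕ} (hd : 0 < d)
    {P : Polynomial (Polynomial K)} (hP : P.Monic) (hPd : P.natDegree = d) :
    (elimHom K d P).coeff (Finsupp.single (0, 2) d) ≠ 0 := by
  have hd0 : (d : K) ≠ 0 := by exact_mod_cast hd.ne'
  have hvw : ((0, 2) : Fin 2 × ℕ) ≠ (0, 1) := by simp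
  set σ : MvPolynomial (Fin 2 × ℕ) K →ₐ[K] Polynomial K :=
    aeval (fun i => if i = (0, 2) then Polynomial.X else 0) with hσ
  have key : (σ : _ →+* Polynomial K).comp (elimHom K d) =
      (Polynomial.compRingHom (Polynomial.C (d : K)⁻¹ * Polynomial.X)).comp
        (Polynomial.mapRingHom (Polynomial.evalRingHom 0)) := by
    ext1
    · ext1
      · ext1 c
        simp [elimHom, hσ]
      · simp [elimHom, hσ, hd.ne']
    · simp [elimHom, hσ]
  have h := RingHom.congr_fun key P
  simp only [RingHom.comp_apply, RingHom.coe_coe, Polynomial.coe_mapRingHom,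
    Polynomial.coe_compRingHom_apply] at h
  rw [coeff_single_eq_coeff_aeval hvw, ← hσ, h]
  exact Polynomial.coeff_comp_C_mul_X_ne_zero (hP.map _) (by rw [hP.natDegree_map, hPd])
    (inv_ne_zero hd0)

theorem coeff_x_mul_x'_elimHom_ne_zero {d e : ℕ} (he : 0 < e) (hed : e < d)
    {P : Polynomial (Polynomial K)} (hP : P.Monic) (hPd : P.natDegree = d)
    (hP0 : (P.coeff 0).natDegree = d + e - 1) :
    (elimHom K d P).coeff (Finsupp.single (0, 0) (d * (d - 1)) + Finsupp.single (0, 1) d) ≠ 0 := by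
  have hvw : ((0, 0) : Fin 2 × ℕ) ≠ (0, 1) := by simp
  set σ : MvPolynomial (Fin 2 × ℕ) K →ₐ[K] Polynomial (Polynomial K) :=
    aeval (fun i => if i = (0, 0) then Polynomial.C Polynomial.X else
      if i = (0, 1) then Polynomial.X else 0) with hσ
  have key : (σ : _ →+* Polynomial (Polynomial K)).comp (elimHom K d) =
      eval₂RingHom (eval₂RingHom ((Polynomial.C : Polynomial K →+* _).comp Polynomial.C)
        (Polynomial.X - Polynomial.C (Polynomial.X ^ d)))
        (Polynomial.C (-Polynomial.X ^ (d - 1)) * Polynomial.X) := by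
    ext1
    · ext1
      · ext1 c
        simp [elimHom, hσ]
      · simp [elimHom, hσ]
    · simp [elimHom, hσ]
      ring
  have h := RingHom.congr_fun key P
  simp only [RingHom.comp_apply, RingHom.coe_coe, Polynomial.coe_eval₂RingHom] at h
  rw [coeff_single_add_single hvw, ← hσ, h]
  exact Polynomial.coeff_eval₂_neg_C_mul_X_ne_zero he hed hP hPd hP0

end System

theorem statement18 (K : Type*) [Field K] [CharZero K] (d₁ d₂ : ℕ)
    (hd₁ : 0 < d₁) (hd₂ : 0 < d₂) :
    (∃ f, IsMinPoly K 2
      (sysIdeal K 2 ![X 0 ^ d₁ + X 1 ^ d₁, X 1 ^ d₂ + 1]) f) ∧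
    ∀ f : MvPolynomial (Fin 2 × ℕ) K,
      IsMinPoly K 2 (sysIdeal K 2 ![X 0 ^ d₁ + X 1 ^ d₁, X 1 ^ d₂ + 1]) f →
      MvPolynomial.coeff (Finsupp.single ((0 : Fin 2), 0) (d₁ * (d₁ + d₂ - 1))) f ≠ 0 ∧
      MvPolynomial.coeff (Finsupp.single ((0 : Fin 2), 2) d₁) f ≠ 0 ∧
      (d₂ < d₁ →
        MvPolynomial.coeff
          (Finsupp.single ((0 : Fin 2), 0) (d₁ * (d₁ - 1)) +
            Finsupp.single ((0 : Fin 2), 1) d₁) f ≠ 0) := by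
  obtain ⟨P, hP, hPd, hP0, hker, hdvd⟩ :=
    Polynomial.exists_generator_ker_eval₂_expand K hd₁ hd₂
  set I := sysIdeal K 2 (powField K d₁ d₂) with hI
  set f₀ := elimHom K d₁ P with hf₀
  have hmem : f₀ ∈ I := elimHom_mem_sysIdeal hd₁ hker
  have hsupp : (↑f₀.vars : Set _) ⊆ lowVars := mem_supported.1 (elimHom_mem_supported d₁ P)
  have hx'' : f₀.coeff (Finsupp.single (0, 2) d₁) ≠ 0 :=
    coeff_x''_elimHom_ne_zero hd₁ hP hPd
  have hf₀0 : f₀ ≠ 0 := fun h => hx'' (by rw [h, coeff_zero])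
  have hvars : ∀ v ∈ f₀.vars, v.1 = 0 := fun v hv => by
    obtain rfl | rfl | rfl := hsupp hv <;> rfl
  have hord : ordOf f₀ ≤ 2 := Finset.sup_le fun v hv => by
    obtain rfl | rfl | rfl := hsupp hv <;> simp
  have hmain : ∀ h ∈ I, (∀ v ∈ h.vars, v.1 = 0) → ordOf h ≤ 2 → f₀ ∣ h := fun h hh hv ho =>
    elimHom_dvd_of_mem_sysIdeal hd₁ hdvd hh (mem_supported_lowVars hv ho)
  have hord_dvd : ∀ h, h ≠ 0 → f₀ ∣ h → 2 ≤ ordOf h := by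
    rintro _ h0 ⟨q, rfl⟩
    have hv : ((0, 2) : Fin 2 × ℕ) ∈ (f₀ * q).vars := by
      rw [mem_vars_iff_degreeOf_ne_zero, degreeOf_mul_eq hf₀0 (right_ne_zero_of_mul h0)]
      have := le_degreeOf_of_mem_support ((0, 2) : Fin 2 × ℕ) (mem_support_iff.2 hx'')
      simp only [Finsupp.single_eq_same] at this
      omega
    exact Finset.le_sup (f := Prod.snd) hv
  have hordeq : ordOf f₀ = 2 := le_antisymm hord (hord_dvd f₀ hf₀0 dvd_rfl)
  refine ⟨⟨f₀, hf₀0, hmem, hvars, fun h h0 hh hv => ⟨?_, fun ho => ?_⟩⟩, ?_⟩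
  · rcases le_total (ordOf h) 2 with ho | ho
    · exact hord.trans (hord_dvd h h0 (hmain h hh hv ho))
    · exact hord.trans ho
  · exact totalDegree_le_of_dvd_of_isDomain (hmain h hh hv (ho.trans hord)) h0
  · rintro f ⟨hf0, hf, hfv, hmin⟩
    obtain ⟨hle, hdeg⟩ := hmin f₀ hf₀0 hmem hvars
    have hdiv := hmain f hf hfv (hle.trans hord)
    have htd := hdeg (hord.trans (hord_dvd f hf0 hdiv))
    obtain ⟨q, rfl⟩ := hdiv
    have hq0 := right_ne_zero_of_mul hf0
    rw [totalDegree_mul_of_isDomain hf₀0 hq0] at htd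
    obtain ⟨c, rfl⟩ : ∃ c, q = C c :=
      ⟨_, totalDegree_eq_zero_iff_eq_C.1 (by omega)⟩
    have hc : c ≠ 0 := fun h => hq0 (by rw [h, C_0])
    simp only [mul_comm f₀, coeff_C_mul]
    exact ⟨mul_ne_zero hc (coeff_x_elimHom_ne_zero hd₁ hP0 hd₂), mul_ne_zero hc hx'',
      fun hlt => mul_ne_zero hc (coeff_x_mul_x'_elimHom_ne_zero hd₂ hlt hP hPd hP0)⟩
end
end

section
/- Let K be a field of characteristic zero and let p_1, ..., p_s ∈ K[x_1, ..., x_n]. Let V be the K-vector space spanned by p_1, ..., p_s and assume r := dim_K V ≥ 1. Introduce s disjoint copies x⃗_1, ..., x⃗_s of the variable tuple (x_1, ..., x_n), and let N := (p_i(x⃗_j))_{1 ≤ i, j ≤ s} be the s × s matrix over the polynomial ring K[x⃗_1, ..., x⃗_s] whose (i, j) entry is p_i evaluated at the variables x⃗_j. Then N has a nonzero r × r minor. -/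
open MvPolynomial

noncomputable section

/-- Linearly independent polynomials over an infinite field admit evaluation points at which
their evaluation matrix is invertible. -/
theorem exists_det_eval_ne_zero_of_linearIndependent {K σ : Type*} [Field K] [Infinite K] {r : ℕ}
    {q : Fin r → MvPolynomial σ K} (hq : LinearIndependent K q) :
    ∃ a : Fin r → σ → K, (Matrix.of fun i j => eval (a j) (q i)).det ≠ 0 := by
  set v : (σ → K) → Fin r → K := fun a i => eval a (q i) with hv
  have hspan : Submodule.span K (Set.range v) = ⊤ := by
    by_contra h
    obtain ⟨f, hf, hle⟩ := Submodule.exists_le_ker_of_lt_top _ (lt_top_iff_ne_top.2 h)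
    apply hf
    have hsum : ∑ i, f (fun j => if i = j then 1 else 0) • q i = 0 := by
      refine MvPolynomial.funext fun a => ?_
      have h0 : f (v a) = 0 := hle (Submodule.subset_span ⟨a, rfl⟩)
      rw [LinearMap.pi_apply_eq_sum_univ] at h0
      simpa [smul_eval, hv, mul_comm] using h0
    have hzero := Fintype.linearIndependent_iff.1 hq _ hsum
    refine LinearMap.ext fun w => ?_
    rw [LinearMap.pi_apply_eq_sum_univ]
    simp [hzero]
  have hfin : Module.finrank K (Submodule.span K (Set.range v)) = r := by
    rw [hspan]; simp
  have hex := Submodule.exists_fun_fin_finrank_span_eq K (Set.range v)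
  rw [hfin] at hex
  obtain ⟨f, hf, -, hli⟩ := hex
  choose a ha using hf
  refine ⟨a, ?_⟩
  have hdet : IsUnit (Matrix.of f) := Matrix.linearIndependent_rows_iff_isUnit.1 hli
  rw [Matrix.isUnit_iff_isUnit_det, isUnit_iff_ne_zero, ← Matrix.det_transpose] at hdet
  convert hdet using 2
  ext i j
  simp [← ha, hv]

theorem statement19 (K : Type*) [Field K] [CharZero K] (n s : ℕ)
    (p : Fin s → MvPolynomial (Fin n) K)
    (r : ℕ) (hr : r = Module.finrank K (Submodule.span K (Set.range p)))
    (hr1 : 1 ≤ r) :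
    ∃ (ri ci : Fin r → Fin s), Function.Injective ri ∧ Function.Injective ci ∧
      (Matrix.submatrix
        (Matrix.of fun i j : Fin s =>
          rename (fun x : Fin n => ((j, x) : Fin s × Fin n)) (p i))
        ri ci).det ≠ 0 := by
  have hinf : Infinite K := Infinite.of_injective _ (Nat.cast_injective (R := K))
  have hfin : FiniteDimensional K (Submodule.span K (Set.range p)) :=
    FiniteDimensional.span_of_finite K (Set.finite_range p)
  have hex := Submodule.exists_fun_fin_finrank_span_eq K (Set.range p)
  rw [← hr] at hex
  obtain ⟨q, hq, -, hli⟩ := hex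
  choose ri hri using hq
  obtain rfl : (fun i => p (ri i)) = q := _root_.funext hri
  have hinj : Function.Injective ri := fun i j h => hli.injective (congrArg p h)
  obtain ⟨a, ha⟩ := exists_det_eval_ne_zero_of_linearIndependent hli
  refine ⟨ri, ri, hinj, hinj, fun h => ha ?_⟩
  have h' := congrArg (eval fun jx : Fin s × Fin n => Function.extend ri a 0 jx.1 jx.2) h
  rw [map_zero, RingHom.map_det] at h'
  rw [← h']
  congr 1
  ext i j
  simp [eval_rename, Function.comp_def, hinj.extend_apply]
end
end
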